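/- Let k ≥ 2 and let embeddings z_c ∈ ℝ^d for c ∈ {0,1}^k satisfy z_c = Σ_{i=1}^{k} u_{i,c_i}. Suppose for each concept i there exist w_i ∈ ℝ^d and b_i ∈ ℝ with ⟪w_i, z_c⟫ + b_i = 2c_i − 1 for every c ∈ {0,1}^k. Then ⟪w_i, u_{j,1} − u_{j,0}⟫ = 0 for all j ≠ i. Consequently, if moreover u_{i,1} − u_{i,0} = (2/‖w_i‖²) w_i for every i (with w_i ≠ 0), then ⟪u_{i,1} − u_{i,0}, u_{j,1} − u_{j,0}⟫ = 0 for all i ≠ j. -/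

import Mathlib

open scoped RealInnerProductSpace

/-- Changing a single coordinate `j` of a multi-index changes a sum of coordinatewise terms only by
the difference of the `j`-th terms. -/
theorem sum_update_sub_sum_update {ι α M : Type*} [Fintype ι] [DecidableEq ι] [AddCommGroup M]
    (u : ι → α → M) (c : ι → α) (j : ι) (x y : α) :
    ∑ i, u i (Function.update c j x i) - ∑ i, u i (Function.update c j y i) = u j x - u j y := by
  rw [← Finset.sum_sub_distrib, Finset.sum_eq_single j]
  · simp
  · intro i _ hij
    simp [hij]
  · simp

/-- **Orthogonality step of the necessity direction.**
If `z c = ∑ i, u i (c i)` and affine readouts satisfy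
`⟪w i, z c⟫ + b i = 2 c i − 1` on the whole hypercube, then each `w i` is
orthogonal to the other concepts' difference vectors; consequently, if each
difference vector is proportional to its readout weight via
`u i 1 − u i 0 = (2/‖w i‖²) w i` (with `w i ≠ 0`), then difference vectors of
distinct concepts are pairwise orthogonal. -/
theorem stmt_14 (k d : ℕ) (hk : 2 ≤ k)
    (u : Fin k → Fin 2 → EuclideanSpace ℝ (Fin d))
    (z : (Fin k → Fin 2) → EuclideanSpace ℝ (Fin d))
    (hz : ∀ c : Fin k → Fin 2, z c = ∑ i, u i (c i))
    (w : Fin k → EuclideanSpace ℝ (Fin d)) (b : Fin k → ℝ)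
    (hw : ∀ (i : Fin k) (c : Fin k → Fin 2),
      ⟪w i, z c⟫ + b i = 2 * ((c i : ℕ) : ℝ) - 1) :
    (∀ i j : Fin k, j ≠ i → ⟪w i, u j 1 - u j 0⟫ = 0) ∧
    ((∀ i : Fin k, w i ≠ 0) →
      (∀ i : Fin k, u i 1 - u i 0 = (2 / ‖w i‖ ^ 2) • w i) →
      ∀ i j : Fin k, i ≠ j → ⟪u i 1 - u i 0, u j 1 - u j 0⟫ = 0) := by
  have horth : ∀ i j : Fin k, j ≠ i → ⟪w i, u j 1 - u j 0⟫ = 0 := by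
    intro i j hji
    have h1 := hw i (Function.update 0 j 1)
    have h0 := hw i (Function.update 0 j 0)
    rw [Function.update_of_ne hji.symm] at h1 h0
    rw [← sum_update_sub_sum_update u 0 j 1 0, ← hz, ← hz, inner_sub_right]
    linarith
  refine ⟨horth, fun _ hprop i j hij => ?_⟩
  rw [hprop i, real_inner_smul_left, horth i j hij.symm, mul_zero]
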